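/- Let A, B, C ∈ ℤ² be non-collinear points such that m := |det(B−A, C−A)| is odd, let i be the number of points of ℤ² in the interior of the triangle conv{A, B, C}, and let b be the number of points of ℤ² on its boundary. Then b is odd and (−1)^{(m−1)/2} = (−1)^{i + (b−3)/2}. -/

import Mathlib

/-- The inclusion of the lattice `ℤ²` into the plane `ℝ²`. -/
def toR (p : ℤ × ℤ) : ℝ × ℝ := ((p.1 : ℝ), (p.2 : ℝ))

/-- The determinant of two integer vectors in `ℤ²`. -/
def det2 (u v : ℤ × ℤ) : ℤ := u.1 * v.2 - u.2 * v.1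

/-- The cross product of two vectors of the real plane. -/
def cross (u v : ℝ × ℝ) : ℝ := u.1 * v.2 - u.2 * v.1

/-- For a positively oriented triangle, the triangle is cut out by the signs of its
barycentric coordinates. -/
theorem convexHull_triangle_eq (a b c : ℝ × ℝ) (h : 0 < cross (b - a) (c - a)) :
    convexHull ℝ {a, b, c} = {p | 0 ≤ cross (p - a) (c - a) ∧ 0 ≤ cross (b - a) (p - a) ∧
      cross (p - a) (c - a) + cross (b - a) (p - a) ≤ cross (b - a) (c - a)} := by
  apply subset_antisymm
  · apply convexHull_min
    · have hself : ∀ v, cross v v = 0 := fun v ↦ by unfold cross; ring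
      have hzero : ∀ v, cross 0 v = 0 ∧ cross v 0 = 0 := fun v ↦ by simp [cross]
      rintro p (rfl | rfl | rfl) <;> simp [hself, hzero, h.le]
    · rintro p ⟨hp1, hp2, hp3⟩ q ⟨hq1, hq2, hq3⟩ s t hs ht hst
      obtain rfl : t = 1 - s := by linarith
      simp only [cross, Set.mem_ofPred_eq, Prod.fst_sub, Prod.snd_sub, Prod.fst_add, Prod.snd_add,
        Prod.smul_fst, Prod.smul_snd, smul_eq_mul] at *
      refine ⟨?_, ?_, ?_⟩
      · linear_combination s * hp1 + (1 - s) * hq1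
      · linear_combination s * hp2 + (1 - s) * hq2
      · linear_combination s * hp3 + (1 - s) * hq3
  · rintro p ⟨h1, h2, h3⟩
    set d := cross (b - a) (c - a) with hd
    set s := cross (p - a) (c - a) with hs
    set t := cross (b - a) (p - a) with ht
    have hp : p = ∑ k : Fin 3, ![(d - s - t) / d, s / d, t / d] k • ![a, b, c] k := by
      have hd' : d ≠ 0 := h.ne'
      simp only [Fin.sum_univ_three, Matrix.cons_val]
      ext
      · simp only [Prod.fst_add, Prod.smul_fst, smul_eq_mul]
        field_simp
        simp only [hd, hs, ht, cross, Prod.fst_sub, Prod.snd_sub]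
        ring
      · simp only [Prod.snd_add, Prod.smul_snd, smul_eq_mul]
        field_simp
        simp only [hd, hs, ht, cross, Prod.fst_sub, Prod.snd_sub]
        ring
    rw [hp]
    refine (convex_convexHull ℝ _).sum_mem ?_ ?_ ?_
    · intro k _
      fin_cases k <;> simp <;> apply div_nonneg <;> linarith
    · simp only [Fin.sum_univ_three, Matrix.cons_val]
      field_simp
      ring
    · intro k _
      apply subset_convexHull
      fin_cases k <;> simp

/-- The interior of a positively oriented triangle is cut out by strict positivity of its
barycentric coordinates. -/
theorem interior_convexHull_triangle_eq (a b c : ℝ × ℝ) (h : 0 < cross (b - a) (c - a)) :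
    interior (convexHull ℝ {a, b, c}) =
      {p | 0 < cross (p - a) (c - a) ∧ 0 < cross (b - a) (p - a) ∧
        cross (p - a) (c - a) + cross (b - a) (p - a) < cross (b - a) (c - a)} := by
  have hT := convexHull_triangle_eq a b c h
  apply subset_antisymm
  · intro p hp
    let g : ℝ × ℝ := (3⁻¹ : ℝ) • (a + b + c)
    have hcont : Filter.Tendsto (fun ε : ℝ ↦ p + ε • (p - g)) (nhds 0) (nhds p) := by
      have : Continuous (fun ε : ℝ ↦ p + ε • (p - g)) := by fun_prop
      simpa using this.tendsto 0
    have hev := hcont.eventually (isOpen_interior.mem_nhds hp)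
    obtain ⟨ε, hε, hpos⟩ :=
      ((hev.filter_mono nhdsWithin_le_nhds).and
        (self_mem_nhdsWithin : Set.Ioi (0 : ℝ) ∈ nhdsWithin 0 (Set.Ioi 0))).exists
    have hmem := interior_subset hε
    rw [hT] at hmem
    obtain ⟨h1, h2, h3⟩ := hmem
    replace hpos : 0 < ε := hpos
    have key : ∀ x d : ℝ, 0 < d → 0 ≤ (1 + ε) * x - ε * (d / 3) → 0 < x := by
      intro x d hd hx
      by_contra! hneg
      nlinarith [mul_pos hpos hd, mul_nonneg hpos.le (neg_nonneg.2 hneg)]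
    refine ⟨key _ _ h ?_, key _ _ h ?_, ?_⟩
    · refine h1.trans_eq ?_
      simp [cross, g]
      ring
    · refine h2.trans_eq ?_
      simp [cross, g]
      ring
    · refine sub_pos.1 (key _ _ h ((sub_nonneg.2 h3).trans_eq ?_))
      simp [cross, g]
      ring
  · apply interior_maximal
    · rw [hT]
      exact fun p hp ↦ ⟨hp.1.le, hp.2.1.le, hp.2.2.le⟩
    · simp only [Set.ofPred_and, cross]
      refine (isOpen_lt ?_ ?_).inter ((isOpen_lt ?_ ?_).inter (isOpen_lt ?_ ?_)) <;> fun_prop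

/-- The half-open lattice parallelogram with base point `A` spanned by `u` and `w` contains
exactly `det2 u w` lattice points. -/
theorem ncard_halfOpen_parallelogram (A u w : ℤ × ℤ) (h : 0 < det2 u w) :
    {p : ℤ × ℤ | 0 ≤ det2 (p - A) w ∧ det2 (p - A) w < det2 u w ∧
      0 ≤ det2 u (p - A) ∧ det2 u (p - A) < det2 u w}.ncard = (det2 u w).natAbs := by
  have hli : LinearIndependent ℤ ![u, w] := by
    rw [LinearIndependent.pair_iff]
    intro s t hst
    have h1 : s * u.1 + t * w.1 = 0 := by simpa using congrArg Prod.fst hst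
    have h2 : s * u.2 + t * w.2 = 0 := by simpa using congrArg Prod.snd hst
    have h3 : s * det2 u w = 0 := by unfold det2; linear_combination w.2 * h1 - w.1 * h2
    have h4 : t * det2 u w = 0 := by unfold det2; linear_combination u.1 * h2 - u.2 * h1
    exact ⟨(mul_eq_zero.1 h3).resolve_right h.ne', (mul_eq_zero.1 h4).resolve_right h.ne'⟩
  set N := Submodule.span ℤ (Set.range ![u, w]) with hN
  have hmemN : ∀ v, v ∈ N ↔ ∃ s t : ℤ, s • u + t • w = v := by
    intro v
    rw [hN, Matrix.range_cons_cons_empty, Submodule.mem_span_pair]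
  have hcard : (det2 u w).natAbs = Nat.card ((ℤ × ℤ) ⧸ N) := by
    rw [← Submodule.natAbs_det_basis_change (Module.Basis.finTwoProd ℤ) N (Module.Basis.span hli),
      Module.Basis.det_apply, Matrix.det_fin_two]
    have h0 := Module.Basis.span_apply hli 0
    have h1 := Module.Basis.span_apply hli 1
    simp only [Matrix.cons_val] at h0 h1
    simp [Module.Basis.toMatrix_apply, h0, h1, det2]
    ring_nf
  rw [hcard, ← Nat.card_coe_set_eq]
  refine Nat.card_congr (Equiv.ofBijective (fun p ↦ N.mkQ p.1) ⟨?_, ?_⟩)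
  · rintro ⟨p, hp1, hp2, hp3, hp4⟩ ⟨q, hq1, hq2, hq3, hq4⟩ hpq
    simp only [Submodule.mkQ_apply] at hpq
    rw [Submodule.Quotient.eq, hmemN] at hpq
    obtain ⟨s, t, hst⟩ := hpq
    have e1 : s * u.1 + t * w.1 = p.1 - q.1 := by simpa using congrArg Prod.fst hst
    have e2 : s * u.2 + t * w.2 = p.2 - q.2 := by simpa using congrArg Prod.snd hst
    have h3 : s * det2 u w = det2 (p - A) w - det2 (q - A) w := by
      simp only [det2, Prod.fst_sub, Prod.snd_sub]; linear_combination w.2 * e1 - w.1 * e2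
    have h4 : t * det2 u w = det2 u (p - A) - det2 u (q - A) := by
      simp only [det2, Prod.fst_sub, Prod.snd_sub]; linear_combination u.1 * e2 - u.2 * e1
    have hzero : ∀ k x y d : ℤ, 0 ≤ x → x < d → 0 ≤ y → y < d → k * d = x - y → k = 0 := by
      intro k x y d _ _ _ _ hk
      have : k < 1 := by by_contra! hc; nlinarith
      have : -1 < k := by by_contra! hc; nlinarith
      omega
    have hs := hzero _ _ _ _ hp1 hp2 hq1 hq2 h3
    have ht := hzero _ _ _ _ hp3 hp4 hq3 hq4 h4
    subst hs ht
    ext <;> simp at e1 e2 ⊢ <;> omega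
  · intro x
    obtain ⟨p, rfl⟩ := N.mkQ_surjective x
    set d := det2 u w with hd
    set s := det2 (p - A) w / d with hs
    set t := det2 u (p - A) / d with ht
    have e1 : det2 (p - s • u - t • w - A) w = det2 (p - A) w % d := by
      rw [Int.emod_def, ← hs]
      simp only [hd, det2, Prod.fst_sub, Prod.snd_sub, Prod.smul_fst, Prod.smul_snd, smul_eq_mul]
      ring
    have e2 : det2 u (p - s • u - t • w - A) = det2 u (p - A) % d := by
      rw [Int.emod_def, ← ht]
      simp only [hd, det2, Prod.fst_sub, Prod.snd_sub, Prod.smul_fst, Prod.smul_snd, smul_eq_mul]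
      ring
    refine ⟨⟨p - s • u - t • w, ?_⟩, ?_⟩
    · simp only [Set.mem_ofPred_eq, e1, e2]
      exact ⟨Int.emod_nonneg _ h.ne', Int.emod_lt_of_pos _ h,
        Int.emod_nonneg _ h.ne', Int.emod_lt_of_pos _ h⟩
    · simp only [Submodule.mkQ_apply]
      rw [Submodule.Quotient.eq, hmemN]
      exact ⟨-s, -t, by module⟩

/-- On lattice vectors, `cross` agrees with the integer determinant. -/
theorem cross_toR (P Q A B : ℤ × ℤ) :
    cross (toR P - toR Q) (toR A - toR B) = (det2 (P - Q) (A - B) : ℝ) := by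
  simp [cross, toR, det2]

/-- **Pick's formula** for a positively oriented lattice triangle, together with the fact
that at least two lattice points lie on the boundary. -/
theorem pick_triangle_of_pos (A B C : ℤ × ℤ) (h : 0 < det2 (B - A) (C - A)) :
    (det2 (B - A) (C - A)).natAbs + 2 =
      2 * {p : ℤ × ℤ |
        toR p ∈ interior (convexHull ℝ ({toR A, toR B, toR C} : Set (ℝ × ℝ)))}.ncard +
      {p : ℤ × ℤ |
        toR p ∈ frontier (convexHull ℝ ({toR A, toR B, toR C} : Set (ℝ × ℝ)))}.ncard ∧
      2 ≤ {p : ℤ × ℤ |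
        toR p ∈ frontier (convexHull ℝ ({toR A, toR B, toR C} : Set (ℝ × ℝ)))}.ncard := by
  have hR : 0 < cross (toR B - toR A) (toR C - toR A) := by
    rw [cross_toR]; exact_mod_cast h
  have hclosed : IsClosed (convexHull ℝ ({toR A, toR B, toR C} : Set (ℝ × ℝ))) :=
    (Set.toFinite _).isClosed_convexHull ℝ
  rw [hclosed.frontier_eq, interior_convexHull_triangle_eq _ _ _ hR,
    convexHull_triangle_eq _ _ _ hR]
  have hF := ncard_halfOpen_parallelogram A (B - A) (C - A) h
  simp only [Set.mem_sdiff, Set.mem_ofPred_eq, cross_toR]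
  norm_cast
  set d := det2 (B - A) (C - A) with hd
  set F := {p : ℤ × ℤ | 0 ≤ det2 (p - A) (C - A) ∧ det2 (p - A) (C - A) < d ∧
      0 ≤ det2 (B - A) (p - A) ∧ det2 (B - A) (p - A) < d} with hFdef
  set I := {p : ℤ × ℤ | 0 < det2 (p - A) (C - A) ∧ 0 < det2 (B - A) (p - A) ∧
      det2 (p - A) (C - A) + det2 (B - A) (p - A) < d} with hI
  set E := {p : ℤ × ℤ | (0 ≤ det2 (p - A) (C - A) ∧ 0 ≤ det2 (B - A) (p - A) ∧
      det2 (p - A) (C - A) + det2 (B - A) (p - A) ≤ d) ∧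
      ¬ (0 < det2 (p - A) (C - A) ∧ 0 < det2 (B - A) (p - A) ∧
      det2 (p - A) (C - A) + det2 (B - A) (p - A) < d)} with hE
  have hFfin : F.Finite := Set.finite_of_ncard_pos (by rw [hF]; omega)
  have hBt : det2 (B - A) (B - A) = 0 := by simp [det2]; ring
  have hCs : det2 (C - A) (C - A) = 0 := by simp [det2]; ring
  have hBC : B ≠ C := by
    rintro rfl
    omega
  have hinj : ∀ p q : ℤ × ℤ, det2 (p - A) (C - A) = det2 (q - A) (C - A) →
      det2 (B - A) (p - A) = det2 (B - A) (q - A) → p = q := by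
    intro p q h1 h2
    have e1 : d * (p.1 - q.1) = 0 := by
      simp only [hd, det2, Prod.fst_sub, Prod.snd_sub] at *
      linear_combination (B.1 - A.1) * h1 + (C.1 - A.1) * h2
    have e2 : d * (p.2 - q.2) = 0 := by
      simp only [hd, det2, Prod.fst_sub, Prod.snd_sub] at *
      linear_combination (B.2 - A.2) * h1 + (C.2 - A.2) * h2
    ext
    · exact sub_eq_zero.1 ((mul_eq_zero.1 e1).resolve_left h.ne')
    · exact sub_eq_zero.1 ((mul_eq_zero.1 e2).resolve_left h.ne')
  have hJ1 : ∀ p, det2 (B + C - p - A) (C - A) = d - det2 (p - A) (C - A) := by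
    intro p
    simp only [hd, det2, Prod.fst_sub, Prod.snd_sub, Prod.fst_add, Prod.snd_add]
    ring
  have hJ2 : ∀ p, det2 (B - A) (B + C - p - A) = d - det2 (B - A) (p - A) := by
    intro p
    simp only [hd, det2, Prod.fst_sub, Prod.snd_sub, Prod.fst_add, Prod.snd_add]
    ring
  set J := (fun p ↦ B + C - p) '' I with hJ
  have hJmem : ∀ p, p ∈ J ↔ det2 (p - A) (C - A) < d ∧ det2 (B - A) (p - A) < d ∧
      d < det2 (p - A) (C - A) + det2 (B - A) (p - A) := by
    intro p
    constructor
    · rintro ⟨q, ⟨h1, h2, h3⟩, rfl⟩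
      simp only [hJ1, hJ2]
      omega
    · rintro ⟨h1, h2, h3⟩
      refine ⟨B + C - p, ?_, by simp⟩
      simp only [hI, Set.mem_ofPred_eq, hJ1, hJ2]
      omega
  have hJcard : J.ncard = I.ncard := Set.ncard_image_of_injective _ sub_right_injective
  have hdecomp : F = (I ∪ J) ∪ (E \ {B, C}) := by
    ext p
    have hpB : p = B ↔ det2 (p - A) (C - A) = d ∧ det2 (B - A) (p - A) = 0 :=
      ⟨by rintro rfl; exact ⟨rfl, hBt⟩, fun hp ↦ hinj _ _ hp.1 (hp.2.trans hBt.symm)⟩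
    have hpC : p = C ↔ det2 (p - A) (C - A) = 0 ∧ det2 (B - A) (p - A) = d :=
      ⟨by rintro rfl; exact ⟨hCs, rfl⟩, fun hp ↦ hinj _ _ (hp.1.trans hCs.symm) hp.2⟩
    simp only [Set.mem_union, Set.mem_sdiff, Set.mem_insert_iff, Set.mem_singleton_iff, hJmem, hpB,
      hpC, hFdef, hI, hE, Set.mem_ofPred_eq]
    omega
  have hIJ : Disjoint I J := by
    rw [Set.disjoint_left]
    intro p hp hp'
    have := (hJmem p).1 hp'
    have := hp.2.2
    omega
  have hIJE : Disjoint (I ∪ J) (E \ {B, C}) := by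
    rw [Set.disjoint_left]
    rintro p (hp | hp) ⟨hp', -⟩
    · exact hp'.2 hp
    · have := (hJmem p).1 hp
      have := hp'.1.2.2
      omega
  have hfin1 : (I ∪ J).Finite := hFfin.subset (hdecomp ▸ Set.subset_union_left)
  have hfin2 : (E \ {B, C}).Finite := hFfin.subset (hdecomp ▸ Set.subset_union_right)
  have hEfin : E.Finite := hfin2.of_sdiff (Set.toFinite _)
  have hsub : {B, C} ⊆ E := by
    rintro p (rfl | rfl)
    · simp only [hE, Set.mem_ofPred_eq, hBt, ← hd]; omega
    · simp only [hE, Set.mem_ofPred_eq, hCs, ← hd]; omega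
  have hEcard := Set.ncard_sdiff_add_ncard_of_subset hsub hEfin
  rw [Set.ncard_pair hBC] at hEcard
  rw [hdecomp, Set.ncard_union_eq hIJE hfin1 hfin2,
    Set.ncard_union_eq hIJ (hfin1.subset Set.subset_union_left)
      (hfin1.subset Set.subset_union_right), hJcard] at hF
  omega

/-- **Pick's formula** for a lattice triangle, together with the fact that at least two lattice points
lie on the boundary. -/
theorem pick_triangle (A B C : ℤ × ℤ) (h : det2 (B - A) (C - A) ≠ 0) :
    (det2 (B - A) (C - A)).natAbs + 2 =
      2 * {p : ℤ × ℤ |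
        toR p ∈ interior (convexHull ℝ ({toR A, toR B, toR C} : Set (ℝ × ℝ)))}.ncard +
      {p : ℤ × ℤ |
        toR p ∈ frontier (convexHull ℝ ({toR A, toR B, toR C} : Set (ℝ × ℝ)))}.ncard ∧
      2 ≤ {p : ℤ × ℤ |
        toR p ∈ frontier (convexHull ℝ ({toR A, toR B, toR C} : Set (ℝ × ℝ)))}.ncard := by
  rcases h.lt_or_gt with hneg | hpos
  · have hswap : det2 (B - A) (C - A) = -det2 (C - A) (B - A) := by unfold det2; ring
    rw [hswap, Int.natAbs_neg, Set.pair_comm (toR B) (toR C)]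
    exact pick_triangle_of_pos A C B (by omega)
  · exact pick_triangle_of_pos A B C hpos

/-- For a lattice triangle of odd normalized area `m = |det(B-A, C-A)|`, the number `b`
of boundary lattice points is odd and `(-1)^{(m-1)/2} = (-1)^{i + (b-3)/2}`, where `i` is
the number of interior lattice points. -/
theorem pick_formula_odd_area (A B C : ℤ × ℤ) (h : det2 (B - A) (C - A) ≠ 0)
    (m : ℕ) (hm : m = (det2 (B - A) (C - A)).natAbs) (hodd : Odd m)
    (i b : ℕ)
    (hi : i = Set.ncard {p : ℤ × ℤ |
      toR p ∈ interior (convexHull ℝ ({toR A, toR B, toR C} : Set (ℝ × ℝ)))})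
    (hb : b = Set.ncard {p : ℤ × ℤ |
      toR p ∈ frontier (convexHull ℝ ({toR A, toR B, toR C} : Set (ℝ × ℝ)))}) :
    Odd b ∧ (-1 : ℤ) ^ ((m - 1) / 2) = (-1 : ℤ) ^ (i + (b - 3) / 2) := by
  obtain ⟨hpick, hb2⟩ := pick_triangle A B C h
  rw [← hm, ← hi, ← hb] at hpick
  rw [← hb] at hb2
  obtain ⟨k, hk⟩ := hodd
  refine ⟨⟨k + 1 - i, by omega⟩, ?_⟩
  congr 1
  omega
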